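/- For every odd integer d ≥ 5, the caterpillar C(2,0,…,0,2) with spine on d − 1 vertices (so of diameter d) has edge-reconstruction number equal to 2. -/

import Mathlib

open SimpleGraph

namespace ErnPaper

/-- The weight of a vertex `v` in a graph `G`: the number of vertices in a largest
connected component of `G - v`. -/
noncomputable def wt {V : Type} [Fintype V] (G : SimpleGraph V) (v : V) : ℕ :=
  sSup {n | ∃ c : (G.induce ({v}ᶜ : Set V)).ConnectedComponent, n = Nat.card c.supp}

/-- The centroid of a graph: the set of vertices of minimum weight. -/
def centroid {V : Type} [Fintype V] (G : SimpleGraph V) : Set V :=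
  {v | ∀ u, wt G v ≤ wt G u}

/-- The edge-reconstruction number of a finite graph `G`: the least `k` for which there exist
`k` distinct edges `e₁, …, e_k` of `G` such that any finite graph `H` having `k` distinct
edges `f₁, …, f_k` with `H - fᵢ ≅ G - eᵢ` for all `i` must be isomorphic to `G`. -/
noncomputable def ern {V : Type} [Fintype V] (G : SimpleGraph V) : ℕ :=
  sInf {k | ∃ s : Finset (Sym2 V), s.card = k ∧ (↑s : Set (Sym2 V)) ⊆ G.edgeSet ∧
    ∀ (W : Type) (_ : Fintype W) (H : SimpleGraph W) (t : Finset (Sym2 W)),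
      (↑t : Set (Sym2 W)) ⊆ H.edgeSet →
      (∃ φ : {e // e ∈ s} ≃ {f // f ∈ t},
        ∀ e : {e // e ∈ s},
          Nonempty (H.deleteEdges {(φ e).1} ≃g G.deleteEdges {e.1})) →
      Nonempty (H ≃g G)}

/-- The spider tree `S_{p,q,r}`: three paths with `p`, `q`, `r` edges respectively,
emanating from a common central vertex. -/
def spider (p q r : ℕ) : SimpleGraph (Unit ⊕ (Fin p ⊕ Fin q ⊕ Fin r)) :=
  SimpleGraph.fromRel fun x y =>
    match x, y with
    | Sum.inl _, Sum.inr (Sum.inl j) => (j : ℕ) = 0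
    | Sum.inl _, Sum.inr (Sum.inr (Sum.inl j)) => (j : ℕ) = 0
    | Sum.inl _, Sum.inr (Sum.inr (Sum.inr j)) => (j : ℕ) = 0
    | Sum.inr (Sum.inl i), Sum.inr (Sum.inl j) => (j : ℕ) = (i : ℕ) + 1
    | Sum.inr (Sum.inr (Sum.inl i)), Sum.inr (Sum.inr (Sum.inl j)) => (j : ℕ) = (i : ℕ) + 1
    | Sum.inr (Sum.inr (Sum.inr i)), Sum.inr (Sum.inr (Sum.inr j)) => (j : ℕ) = (i : ℕ) + 1
    | _, _ => False

/-- A pseudopath: a tree isomorphic to a path `P_k`, to `S_{1,1,2}`, or to `S_{1,2,3}`. -/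
def IsPseudopath {V : Type} (T : SimpleGraph V) : Prop :=
  (∃ k, Nonempty (T ≃g pathGraph k)) ∨
    Nonempty (T ≃g spider 1 1 2) ∨ Nonempty (T ≃g spider 1 2 3)

/-- `T - xv + yv`: delete the end-edge `xv` and add the new edge `yv`. -/
def replaceEdge {V : Type} (T : SimpleGraph V) (x v y : V) : SimpleGraph V :=
  SimpleGraph.fromEdgeSet ((T.edgeSet \ {s(x, v)}) ∪ {s(y, v)})

/-- The disjoint union of two simple graphs. -/
def disjUnion {α β : Type} (G : SimpleGraph α) (H : SimpleGraph β) :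
    SimpleGraph (α ⊕ β) :=
  SimpleGraph.fromRel fun x y =>
    match x, y with
    | Sum.inl a, Sum.inl b => G.Adj a b
    | Sum.inr a, Sum.inr b => H.Adj a b
    | _, _ => False

/-- The caterpillar `C(2,0,…,0,2)` with spine on `m` vertices: spine path `v₀ … v_{m-1}`,
with two extra endvertices adjacent to `v₀` and two to `v_{m-1}`. -/
def doubleBroom (m : ℕ) : SimpleGraph (Fin m ⊕ Fin 4) :=
  SimpleGraph.fromRel fun x y =>
    match x, y with
    | Sum.inl i, Sum.inl j => (j : ℕ) = (i : ℕ) + 1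
    | Sum.inl i, Sum.inr l =>
        ((i : ℕ) = 0 ∧ (l : ℕ) < 2) ∨ ((i : ℕ) = m - 1 ∧ 2 ≤ (l : ℕ))
    | _, _ => False


/-- Oriented adjacency of the relabelled double broom on `{0,…,2k+3}`. -/
def baseR (k i j : ℕ) : Prop :=
  (i = 0 ∧ j = 2) ∨ (i = 2*k+1 ∧ j = 2*k+3) ∨ (1 ≤ i ∧ j = i+1 ∧ j ≤ 2*k+2)

/-- Relabelled double broom minus the edge `{c, c+1}`. -/
def cutR (k c i j : ℕ) : Prop := (baseR k i j ∧ i ≠ c) ∨ (baseR k j i ∧ j ≠ c)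

lemma card_fin_le (n a : ℕ) (h : a < n) :
    (Finset.univ.filter (fun u : Fin n => (u:ℕ) ≤ a)).card = a + 1 := by
  have : Finset.univ.filter (fun u : Fin n => (u:ℕ) ≤ a) = Finset.Iic (⟨a, h⟩ : Fin n) := by
    ext u; simp [Fin.le_def]
  rw [this]; simp

lemma card_fin_gt (n a : ℕ) (h : a < n) :
    (Finset.univ.filter (fun u : Fin n => ¬ (u:ℕ) ≤ a)).card = n - (a + 1) := by
  have := Finset.card_filter_add_card_filter_not (s := (Finset.univ : Finset (Fin n)))
    (fun u : Fin n => (u:ℕ) ≤ a)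
  rw [card_fin_le n a h] at this
  simp only [Finset.card_univ, Fintype.card_fin] at this
  omega

lemma right_const (k c : ℕ) (hc : c < 2*k+1) (Q : ℕ → Prop)
    (h : ∀ i j, c < i → baseR k i j → (Q i ↔ Q j)) :
    ∀ i, c + 1 ≤ i → i ≤ 2*k+3 → (Q i ↔ Q (c+1)) := by
  have h1 : ∀ i, c + 1 ≤ i → i ≤ 2*k+2 → (Q i ↔ Q (c+1)) := by
    intro i hi
    induction i, hi using Nat.le_induction with
    | base => intro _; rfl
    | succ i hi ih =>
      intro h2
      rw [← ih (by omega)]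
      exact (h i (i+1) (by omega) (by unfold baseR; omega)).symm
  intro i hi h2
  by_cases h3 : i ≤ 2*k+2
  · exact h1 i hi h3
  · have : i = 2*k+3 := by omega
    subst this
    rw [← h1 (2*k+1) (by omega) (by omega)]
    exact (h (2*k+1) (2*k+3) (by omega) (by unfold baseR; omega)).symm

/-- Both halves: the images under `ψ⁻¹`. -/
lemma card_T (k : ℕ) (ψ : Fin (2*k+4) ≃ Fin (2*k+4)) :
    (Finset.univ.filter (fun u => ((ψ u : Fin _):ℕ) ≤ k)).card = k + 1 := by
  rw [← card_fin_le (2*k+4) k (by omega)]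
  exact Finset.card_bij (fun u _ => ψ u) (by simp) (by simp)
    (fun b hb => ⟨ψ.symm b, by simpa using hb, by simp⟩)

lemma card_Tc (k : ℕ) (ψ : Fin (2*k+4) ≃ Fin (2*k+4)) :
    (Finset.univ.filter (fun u => ¬ ((ψ u : Fin _):ℕ) ≤ k)).card = k + 3 := by
  have h := card_fin_gt (2*k+4) k (by omega)
  rw [show k + 3 = 2*k+4 - (k+1) by omega, ← h]
  exact Finset.card_bij (fun u _ => ψ u) (by simp) (by simp)
    (fun b hb => ⟨ψ.symm b, by simpa using hb, by simp⟩)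

/-- The added edge must join the two halves. -/
lemma cross (k : ℕ) (hk : 2 ≤ k) (x y p q : Fin (2*k+4))
    (ψ : Fin (2*k+4) ≃ Fin (2*k+4))
    (hψ : ∀ u v, cutR k k (ψ u) (ψ v) ↔
      ((cutR k (k+1) u v ∨ (u = x ∧ v = y) ∨ (u = y ∧ v = x)) ∧
        ¬ ((u = p ∧ v = q) ∨ (u = q ∧ v = p)))) :
    ¬ ((x:ℕ) ≤ k+1 ↔ (y:ℕ) ≤ k+1) := by
  intro hxy
  let Q : ℕ → Prop := fun i => ∃ h : i < 2*k+4, ((ψ.symm ⟨i, h⟩ : Fin _):ℕ) ≤ k+1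
  have hQ := right_const k k (by omega) Q (by
    intro i j hi hb
    have hi' : i < 2*k+4 := by unfold baseR at hb; omega
    have hj' : j < 2*k+4 := by unfold baseR at hb; omega
    have h1 := (hψ (ψ.symm ⟨i,hi'⟩) (ψ.symm ⟨j,hj'⟩)).1
      (by simp only [Equiv.apply_symm_apply]; left; exact ⟨hb, by omega⟩)
    have h2 := h1.1
    simp only [Q, hi', hj', exists_true_left]
    generalize ψ.symm ⟨i,hi'⟩ = a at *
    generalize ψ.symm ⟨j,hj'⟩ = b at *
    rcases h2 with h2 | ⟨rfl, rfl⟩ | ⟨rfl, rfl⟩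
    · unfold cutR baseR at h2; omega
    · exact hxy
    · exact hxy.symm) 
  have key : ∀ u, ¬ ((ψ u : Fin _):ℕ) ≤ k → ((u:ℕ) ≤ k+1 ↔ Q (k+1)) := by
    intro u hu
    have := hQ (ψ u) (by omega) (by omega)
    simp only [Q, Fin.is_lt, exists_true_left, Fin.eta, Equiv.symm_apply_apply] at this
    exact this
  have c := card_Tc k ψ
  by_cases hq : Q (k+1)
  · have hs : Finset.univ.filter (fun u => ¬ ((ψ u : Fin _):ℕ) ≤ k) ⊆
      Finset.univ.filter (fun u : Fin (2*k+4) => (u:ℕ) ≤ k+1) := by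
      intro u hu
      simp only [Finset.mem_filter, Finset.mem_univ, true_and] at hu ⊢
      exact (key u hu).2 hq
    have := Finset.card_le_card hs
    rw [c, card_fin_le _ _ (by omega)] at this
    omega
  · have hs : Finset.univ.filter (fun u => ¬ ((ψ u : Fin _):ℕ) ≤ k) ⊆
      Finset.univ.filter (fun u : Fin (2*k+4) => ¬ (u:ℕ) ≤ k+1) := by
      intro u hu
      simp only [Finset.mem_filter, Finset.mem_univ, true_and] at hu ⊢
      exact fun h => hq ((key u hu).1 h)
    have := Finset.card_le_card hs
    rw [c, card_fin_gt _ _ (by omega)] at this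
    omega

/-- If the second deleted edge is in the left half, then `T` is the left half minus `x`. -/
lemma T_eq (k : ℕ) (hk : 2 ≤ k) (x y p q : Fin (2*k+4))
    (ψ : Fin (2*k+4) ≃ Fin (2*k+4))
    (hψ : ∀ u v, cutR k k (ψ u) (ψ v) ↔
      ((cutR k (k+1) u v ∨ (u = x ∧ v = y) ∨ (u = y ∧ v = x)) ∧
        ¬ ((u = p ∧ v = q) ∨ (u = q ∧ v = p))))
    (hx : (x:ℕ) ≤ k+1) (hy : k+1 < (y:ℕ)) (hp : (p:ℕ) ≤ k+1) (hq : (q:ℕ) ≤ k+1) :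
    ∀ u, ((ψ u : Fin _):ℕ) ≤ k ↔ ((u:ℕ) ≤ k+1 ∧ u ≠ x) := by
  let Q : ℕ → Prop := fun i => ∃ h : i < 2*k+4, ((ψ ⟨i, h⟩ : Fin _):ℕ) ≤ k
  have closed : ∀ u v, cutR k k (ψ u) (ψ v) → (((ψ u : Fin _):ℕ) ≤ k ↔ ((ψ v : Fin _):ℕ) ≤ k) := by
    intro u v h
    unfold cutR baseR at h; omega
  have hQ := right_const k (k+1) (by omega) Q (by
    intro i j hi hb
    have hi' : i < 2*k+4 := by unfold baseR at hb; omega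
    have hj' : j < 2*k+4 := by unfold baseR at hb; omega
    simp only [Q, hi', hj', exists_true_left]
    apply closed
    rw [hψ]
    refine ⟨Or.inl (Or.inl ⟨hb, by simp; omega⟩), ?_⟩
    simp only [Fin.ext_iff]
    omega) 
  have key : ∀ u : Fin (2*k+4), k+1 < (u:ℕ) → (((ψ u : Fin _):ℕ) ≤ k ↔ Q (k+2)) := by
    intro u hu
    have := hQ u (by omega) (by omega)
    simp only [Q, Fin.is_lt, exists_true_left, Fin.eta] at this
    exact this
  have nQ : ¬ Q (k+2) := by
    intro hq
    have hs : Finset.univ.filter (fun u : Fin (2*k+4) => ¬ (u:ℕ) ≤ k+1) ⊆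
      Finset.univ.filter (fun u => ((ψ u : Fin _):ℕ) ≤ k) := by
      intro u hu
      simp only [Finset.mem_filter, Finset.mem_univ, true_and] at hu ⊢
      exact (key u (by omega)).2 hq
    have := Finset.card_le_card hs
    rw [card_T, card_fin_gt _ _ (by omega)] at this
    omega
  have hxT : ¬ ((ψ x : Fin _):ℕ) ≤ k := by
    rw [closed x y, key y hy]
    · exact nQ
    · rw [hψ]
      refine ⟨Or.inr (Or.inl ⟨rfl, rfl⟩), ?_⟩
      simp only [Fin.ext_iff]
      omega
  have hs : insert x (Finset.univ.filter (fun u : Fin (2*k+4) => ¬ (u:ℕ) ≤ k+1)) ⊆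
      Finset.univ.filter (fun u => ¬ ((ψ u : Fin _):ℕ) ≤ k) := by
    intro u hu
    simp only [Finset.mem_insert, Finset.mem_filter, Finset.mem_univ, true_and] at hu ⊢
    rcases hu with rfl | hu
    · exact hxT
    · rw [key u (by omega)]; exact nQ
  have he := Finset.eq_of_subset_of_card_le hs (by
    rw [card_Tc, Finset.card_insert_of_notMem (by simpa using hx), card_fin_gt _ _ (by omega)]
    omega)
  intro u
  have := Finset.ext_iff.1 he u
  simp only [Finset.mem_insert, Finset.mem_filter, Finset.mem_univ, true_and] at this
  tauto

lemma x_leaf (k : ℕ) (hk : 2 ≤ k) (x y p q : Fin (2*k+4))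
    (ψ : Fin (2*k+4) ≃ Fin (2*k+4))
    (hψ : ∀ u v, cutR k k (ψ u) (ψ v) ↔
      ((cutR k (k+1) u v ∨ (u = x ∧ v = y) ∨ (u = y ∧ v = x)) ∧
        ¬ ((u = p ∧ v = q) ∨ (u = q ∧ v = p))))
    (hx : (x:ℕ) ≤ k+1)
    (hT : ∀ u, ((ψ u : Fin _):ℕ) ≤ k ↔ ((u:ℕ) ≤ k+1 ∧ u ≠ x)) :
    ((x:ℕ) = 0 ∨ (x:ℕ) = 1 ∨ (x:ℕ) = k+1) ∧
    ∀ z : Fin (2*k+4), (z:ℕ) ≤ k+1 → cutR k (k+1) x z →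
      (x = p ∧ z = q) ∨ (x = q ∧ z = p) := by
  have hN : ∀ z : Fin (2*k+4), (z:ℕ) ≤ k+1 → cutR k (k+1) x z →
      (x = p ∧ z = q) ∨ (x = q ∧ z = p) := by
    intro z hz hxz
    by_contra hcon
    have adj := (hψ x z).2 ⟨Or.inl hxz, hcon⟩
    have h1 := hT z
    have h2 := hT x
    have h3 : z ≠ x := by
      rintro rfl
      unfold cutR baseR at hxz; omega
    have h4 : ((ψ z : Fin _):ℕ) ≤ k := h1.2 ⟨hz, h3⟩
    have h5 : ¬ ((ψ x : Fin _):ℕ) ≤ k := fun h => (h2.1 h).2 rfl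
    unfold cutR baseR at adj; omega
  refine ⟨?_, hN⟩
  by_contra hcon
  by_cases h2 : (x:ℕ) = 2
  · have a := hN ⟨0, by omega⟩ (by simp) (by unfold cutR baseR; simp; omega)
    have b := hN ⟨1, by omega⟩ (by simp) (by unfold cutR baseR; simp; omega)
    simp only [Fin.ext_iff] at a b
    omega
  · have a := hN ⟨x-1, by omega⟩ (by simp; omega) (by unfold cutR baseR; simp; omega)
    have b := hN ⟨x+1, by omega⟩ (by simp; omega) (by unfold cutR baseR; simp; omega)
    simp only [Fin.ext_iff] at a b
    omega

lemma x_long (k : ℕ) (hk : 3 ≤ k) (x y p q : Fin (2*k+4))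
    (ψ : Fin (2*k+4) ≃ Fin (2*k+4))
    (hψ : ∀ u v, cutR k k (ψ u) (ψ v) ↔
      ((cutR k (k+1) u v ∨ (u = x ∧ v = y) ∨ (u = y ∧ v = x)) ∧
        ¬ ((u = p ∧ v = q) ∨ (u = q ∧ v = p))))
    (hx : (x:ℕ) = 0 ∨ (x:ℕ) = 1 ∨ (x:ℕ) = k+1)
    (hT : ∀ u, ((ψ u : Fin _):ℕ) ≤ k ↔ ((u:ℕ) ≤ k+1 ∧ u ≠ x)) :
    (x:ℕ) = k+1 := by
  have get : ∀ i : ℕ, i ≤ k → ∃ u : Fin (2*k+4), ((ψ u : Fin _):ℕ) = i ∧ (u:ℕ) ≤ k+1 ∧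
      (u:ℕ) ≠ x := by
    intro i hi
    refine ⟨ψ.symm ⟨i, by omega⟩, by simp, ?_⟩
    have := (hT (ψ.symm ⟨i, by omega⟩)).1 (by simpa using hi)
    exact ⟨this.1, fun h => this.2 (Fin.ext h)⟩
  obtain ⟨w, hw, hw1, hw2⟩ := get 2 (by omega)
  obtain ⟨a, ha, ha1, ha2⟩ := get 0 (by omega)
  obtain ⟨b, hb, hb1, hb2⟩ := get 1 (by omega)
  obtain ⟨c, hc, hc1, hc2⟩ := get 3 (by omega)
  have nab : (a:ℕ) ≠ b := by
    intro h; rw [Fin.ext h] at ha; omega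
  have nac : (a:ℕ) ≠ c := by
    intro h; rw [Fin.ext h] at ha; omega
  have nbc : (b:ℕ) ≠ c := by
    intro h; rw [Fin.ext h] at hb; omega
  have step : ∀ z : Fin (2*k+4), (z:ℕ) ≠ x → cutR k k (ψ w) (ψ z) → cutR k (k+1) w z := by
    intro z hz h
    rcases ((hψ w z).1 h).1 with h | ⟨h, _⟩ | ⟨_, h⟩
    · exact h
    · exact absurd (congrArg Fin.val h) hw2
    · exact absurd (congrArg Fin.val h) hz
  have A := step a ha2 (by rw [hw, ha]; unfold cutR baseR; omega)
  have B := step b hb2 (by rw [hw, hb]; unfold cutR baseR; omega)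
  have C := step c hc2 (by rw [hw, hc]; unfold cutR baseR; omega)
  clear step get hψ hT
  unfold cutR baseR at A B C
  by_contra hcon
  have h2 : (w:ℕ) = 2 := by omega
  omega

/-- A vertex on the right with three distinct neighbours is the right centre. -/
lemma three_right (k i a b c : ℕ) (hi : k < i)
    (hab : a ≠ b) (hac : a ≠ c) (hbc : b ≠ c)
    (ha : cutR k k i a) (hb : cutR k k i b) (hc : cutR k k i c) : i = 2*k+1 := by
  unfold cutR baseR at *; omega

lemma nbr_centre (k i : ℕ) (hk : 2 ≤ k) (h : cutR k k (2*k+1) i) :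
    i = 2*k ∨ i = 2*k+2 ∨ i = 2*k+3 := by
  unfold cutR baseR at h; omega

lemma not_end (k i j : ℕ) (hj : 2*k+1 ≠ j) (h : cutR k k i j) :
    i ≠ 2*k+2 ∧ i ≠ 2*k+3 := by
  unfold cutR baseR at h; omega

lemma y_leaf (k : ℕ) (hk : 2 ≤ k) (x y p q : Fin (2*k+4))
    (ψ : Fin (2*k+4) ≃ Fin (2*k+4))
    (hψ : ∀ u v, cutR k k (ψ u) (ψ v) ↔
      ((cutR k (k+1) u v ∨ (u = x ∧ v = y) ∨ (u = y ∧ v = x)) ∧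
        ¬ ((u = p ∧ v = q) ∨ (u = q ∧ v = p))))
    (hx : (x:ℕ) ≤ k+1) (hy : k+1 < (y:ℕ)) (hp : (p:ℕ) ≤ k+1) (hq : (q:ℕ) ≤ k+1)
    (hT : ∀ u, ((ψ u : Fin _):ℕ) ≤ k ↔ ((u:ℕ) ≤ k+1 ∧ u ≠ x)) :
    ((y:ℕ) = k+2 ∨ (y:ℕ) = 2*k+2 ∨ (y:ℕ) = 2*k+3) ∧ (3 ≤ k → (y:ℕ) = k+2) := by
  have inj : ∀ u v : Fin (2*k+4), (u:ℕ) ≠ v → ((ψ u : Fin _):ℕ) ≠ ψ v := by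
    intro u v h h2
    exact h (congrArg Fin.val (ψ.injective (Fin.ext h2)))
  have hR : ∀ u : Fin (2*k+4), k+1 < (u:ℕ) → k < ((ψ u : Fin _):ℕ) := by
    intro u hu
    have := (hT u).1
    by_contra h
    have := (this (by omega)).1
    omega
  have adjR : ∀ u v : Fin (2*k+4), k+1 < (u:ℕ) → cutR k (k+1) u v → cutR k k (ψ u) (ψ v) := by
    intro u v hu h
    rw [hψ]
    refine ⟨Or.inl h, ?_⟩
    simp only [Fin.ext_iff]; omega
  have adjx : cutR k k (ψ y) (ψ x) := by
    rw [hψ]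
    refine ⟨Or.inr (Or.inr ⟨rfl, rfl⟩), ?_⟩
    simp only [Fin.ext_iff]; omega
  let v0 : Fin (2*k+4) := ⟨2*k, by omega⟩
  let v1 : Fin (2*k+4) := ⟨2*k+1, by omega⟩
  let v2 : Fin (2*k+4) := ⟨2*k+2, by omega⟩
  let v3 : Fin (2*k+4) := ⟨2*k+3, by omega⟩
  have e0 : cutR k k (ψ v1) (ψ v0) := adjR _ _ (by simp [v1]; omega)
    (by unfold cutR baseR; simp [v0, v1]; omega)
  have e2 : cutR k k (ψ v1) (ψ v2) := adjR _ _ (by simp [v1]; omega)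
    (by unfold cutR baseR; simp [v1, v2]; omega)
  have e3 : cutR k k (ψ v1) (ψ v3) := adjR _ _ (by simp [v1]; omega)
    (by unfold cutR baseR; simp [v1, v3]; omega)
  have n02 := inj v0 v2 (by simp [v0, v2])
  have n03 := inj v0 v3 (by simp [v0, v3])
  have n23 := inj v2 v3 (by simp [v2, v3])
  have hc : ((ψ v1 : Fin _):ℕ) = 2*k+1 :=
    three_right k _ _ _ _ (hR v1 (by simp [v1]; omega)) n02 n03 n23 e0 e2 e3
  have y1 : (y:ℕ) ≠ 2*k+1 := by
    intro h
    have hyv : y = v1 := Fin.ext h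
    rw [hyv] at adjx
    have m0 := inj x v0 (by simp [v0]; omega)
    have m2 := inj x v2 (by simp [v2]; omega)
    have m3 := inj x v3 (by simp [v3]; omega)
    unfold cutR baseR at adjx e0 e2 e3
    omega
  have hleaf : (y:ℕ) = k+2 ∨ (y:ℕ) = 2*k+2 ∨ (y:ℕ) = 2*k+3 := by
    by_contra hcon
    have f1 := adjR y ⟨y-1, by omega⟩ hy (by unfold cutR baseR; simp; omega)
    have f2 := adjR y ⟨y+1, by omega⟩ hy (by unfold cutR baseR; simp; omega)
    have := three_right k _ _ _ _ (hR y hy) (inj _ _ (by simp; omega)) (inj _ _ (by simp; omega))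
      (inj _ _ (by simp)) adjx f1 f2
    exact inj y v1 (by simp [v1]; omega) (by omega)
  refine ⟨hleaf, fun hk3 => ?_⟩
  have g0 : cutR k k (ψ v0) (ψ ⟨2*k-1, by omega⟩) := adjR _ _ (by simp [v0]; omega)
    (by unfold cutR baseR; simp [v0]; omega)
  have i0 := inj v1 ⟨2*k-1, by omega⟩ (by simp [v1]; omega)
  have i1 := inj v1 x (by simp [v1]; omega)
  rw [hc] at i0 i1 e0 e2 e3
  have t0 := nbr_centre k _ hk e0
  have t2 := nbr_centre k _ hk e2
  have t3 := nbr_centre k _ hk e3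
  have s0 := not_end k _ _ i0 g0
  by_contra hcon
  rcases hleaf with h | h | h
  · omega
  · have hyv : y = v2 := Fin.ext h
    rw [hyv] at adjx
    have s1 := not_end k _ _ i1 adjx
    omega
  · have hyv : y = v3 := Fin.ext h
    rw [hyv] at adjx
    have s1 := not_end k _ _ i1 adjx
    omega

instance (k c i j : ℕ) : Decidable (cutR k c i j) := by
  unfold cutR baseR; infer_instance

lemma swap_two : ∀ x y : Fin 8, ((x:ℕ) = 0 ∨ (x:ℕ) = 1 ∨ (x:ℕ) = 3) →
    ((y:ℕ) = 4 ∨ (y:ℕ) = 6 ∨ (y:ℕ) = 7) → ∀ u v : Fin 8,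
    (cutR 2 3 ((Equiv.swap x 3 * Equiv.swap y 4 : Equiv.Perm (Fin 8)) u)
      ((Equiv.swap x 3 * Equiv.swap y 4 : Equiv.Perm (Fin 8)) v) ↔ cutR 2 3 u v) := by
  decide +kernel

lemma swap_two' : ∀ x y : Fin 8, ((x:ℕ) = 0 ∨ (x:ℕ) = 1 ∨ (x:ℕ) = 3) →
    ((y:ℕ) = 4 ∨ (y:ℕ) = 6 ∨ (y:ℕ) = 7) → 
    ((Equiv.swap x 3 * Equiv.swap y 4 : Equiv.Perm (Fin 8)) x = 3 ∧
     (Equiv.swap x 3 * Equiv.swap y 4 : Equiv.Perm (Fin 8)) y = 4) := by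
  decide +kernel

lemma core1 (k : ℕ) (hk : 2 ≤ k) (x y p q : Fin (2*k+4))
    (ψ : Fin (2*k+4) ≃ Fin (2*k+4))
    (hψ : ∀ u v, cutR k k (ψ u) (ψ v) ↔
      ((cutR k (k+1) u v ∨ (u = x ∧ v = y) ∨ (u = y ∧ v = x)) ∧
        ¬ ((u = p ∧ v = q) ∨ (u = q ∧ v = p))))
    (hx : (x:ℕ) ≤ k+1) (hy : k+1 < (y:ℕ)) (hp : (p:ℕ) ≤ k+1) (hq : (q:ℕ) ≤ k+1) :
    ∃ σ : Fin (2*k+4) ≃ Fin (2*k+4), (∀ u v, cutR k (k+1) (σ u) (σ v) ↔ cutR k (k+1) u v) ∧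
      (((σ x : Fin _):ℕ) = k+1 ∧ ((σ y : Fin _):ℕ) = k+2) := by
  have hT := T_eq k hk x y p q ψ hψ hx hy hp hq
  have hl := (x_leaf k hk x y p q ψ hψ hx hT).1
  have hyl := y_leaf k hk x y p q ψ hψ hx hy hp hq hT
  by_cases h3 : 3 ≤ k
  · refine ⟨Equiv.refl _, fun u v => Iff.rfl, ?_, hyl.2 h3⟩
    exact x_long k h3 x y p q ψ hψ hl hT
  · have : k = 2 := by omega
    subst this
    refine ⟨(Equiv.swap x (3 : Fin 8) * Equiv.swap y (4 : Fin 8) : Equiv.Perm (Fin 8)),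
      swap_two x y hl hyl.1, ?_⟩
    have := swap_two' x y hl hyl.1
    exact ⟨congrArg Fin.val this.1, congrArg Fin.val this.2⟩

lemma cutR_rev (k : ℕ) (hk : 2 ≤ k) (u v : Fin (2*k+4)) :
    cutR k (k+1) (Fin.rev u) (Fin.rev v) ↔ cutR k (k+1) u v := by
  unfold cutR baseR
  simp only [Fin.val_rev]
  omega

lemma core2 (k : ℕ) (hk : 2 ≤ k) (x y p q : Fin (2*k+4))
    (ψ : Fin (2*k+4) ≃ Fin (2*k+4))
    (hψ : ∀ u v, cutR k k (ψ u) (ψ v) ↔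
      ((cutR k (k+1) u v ∨ (u = x ∧ v = y) ∨ (u = y ∧ v = x)) ∧
        ¬ ((u = p ∧ v = q) ∨ (u = q ∧ v = p))))
    (hx : (x:ℕ) ≤ k+1) (hy : k+1 < (y:ℕ)) (hpq : cutR k (k+1) p q) :
    ∃ σ : Fin (2*k+4) ≃ Fin (2*k+4), (∀ u v, cutR k (k+1) (σ u) (σ v) ↔ cutR k (k+1) u v) ∧
      ((((σ x : Fin _):ℕ) = k+1 ∧ ((σ y : Fin _):ℕ) = k+2) ∨
       (((σ x : Fin _):ℕ) = k+2 ∧ ((σ y : Fin _):ℕ) = k+1)) := by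
  by_cases hp : (p:ℕ) ≤ k+1
  · have hq : (q:ℕ) ≤ k+1 := by unfold cutR baseR at hpq; omega
    obtain ⟨σ, h1, h2⟩ := core1 k hk x y p q ψ hψ hx hy hp hq
    exact ⟨σ, h1, Or.inl h2⟩
  · have hq : ¬ (q:ℕ) ≤ k+1 := by unfold cutR baseR at hpq; omega
    obtain ⟨σ, h1, h2⟩ := core1 k hk (Fin.rev y) (Fin.rev x) (Fin.rev p) (Fin.rev q)
      (Fin.revPerm.trans ψ) (by
        intro u v
        simp only [Equiv.trans_apply, Fin.revPerm_apply]
        rw [hψ, cutR_rev k hk]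
        simp only [Fin.rev_eq_iff]
        tauto) (by simp only [Fin.val_rev]; omega) (by simp only [Fin.val_rev]; omega)
        (by simp only [Fin.val_rev]; omega) (by simp only [Fin.val_rev]; omega)
    refine ⟨Fin.revPerm.trans σ, ?_, Or.inr ?_⟩
    · intro u v
      simp only [Equiv.trans_apply, Fin.revPerm_apply]
      rw [h1, cutR_rev k hk]
    · simp only [Equiv.trans_apply, Fin.revPerm_apply]
      exact ⟨h2.2, h2.1⟩

lemma core3 (k : ℕ) (hk : 2 ≤ k) (x y p q : Fin (2*k+4))
    (ψ : Fin (2*k+4) ≃ Fin (2*k+4))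
    (hψ : ∀ u v, cutR k k (ψ u) (ψ v) ↔
      ((cutR k (k+1) u v ∨ (u = x ∧ v = y) ∨ (u = y ∧ v = x)) ∧
        ¬ ((u = p ∧ v = q) ∨ (u = q ∧ v = p))))
    (hpq : cutR k (k+1) p q) :
    ∃ σ : Fin (2*k+4) ≃ Fin (2*k+4), (∀ u v, cutR k (k+1) (σ u) (σ v) ↔ cutR k (k+1) u v) ∧
      ((((σ x : Fin _):ℕ) = k+1 ∧ ((σ y : Fin _):ℕ) = k+2) ∨
       (((σ x : Fin _):ℕ) = k+2 ∧ ((σ y : Fin _):ℕ) = k+1)) := by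
  have hc := cross k hk x y p q ψ hψ
  by_cases hx : (x:ℕ) ≤ k+1
  · exact core2 k hk x y p q ψ hψ hx (by omega) hpq
  · obtain ⟨σ, h1, h2⟩ := core2 k hk y x p q ψ (by
      intro u v; rw [hψ]; tauto) (by tauto) (by omega) hpq
    exact ⟨σ, h1, by tauto⟩

/-- Numeric label of a vertex of the double broom with spine on `2k` vertices. -/
def code (k : ℕ) : Fin (2*k) ⊕ Fin 4 → Fin (2*k+4)
  | Sum.inl i => ⟨i + 2, by omega⟩
  | Sum.inr l => ⟨if (l:ℕ) < 2 then l else 2*k + l, by split_ifs <;> omega⟩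

lemma code_inj (k : ℕ) : Function.Injective (code k) := by
  rintro (i | i) (j | j) h <;> simp only [code, Fin.mk.injEq] at h
  · congr 1; exact Fin.ext (by omega)
  · split_ifs at h <;> omega
  · split_ifs at h <;> omega
  · congr 1; apply Fin.ext; split_ifs at h <;> omega

noncomputable def codeEquiv (k : ℕ) : (Fin (2*k) ⊕ Fin 4) ≃ Fin (2*k+4) :=
  Equiv.ofBijective (code k)
    ((Fintype.bijective_iff_injective_and_card _).2 ⟨code_inj k, by simp⟩)

lemma codeEquiv_inl (k : ℕ) (i : Fin (2*k)) : ((codeEquiv k (Sum.inl i) : Fin _) : ℕ) = i + 2 := rfl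

lemma codeEquiv_inr (k : ℕ) (l : Fin 4) :
    ((l:ℕ) < 2 ∧ ((codeEquiv k (Sum.inr l) : Fin _) : ℕ) = l) ∨
    (2 ≤ (l:ℕ) ∧ ((codeEquiv k (Sum.inr l) : Fin _) : ℕ) = 2*k + l) := by
  have h : ((codeEquiv k (Sum.inr l) : Fin _) : ℕ) =
    if (l:ℕ) < 2 then (l:ℕ) else 2*k + l := rfl
  rw [h]
  split_ifs <;> omega

lemma broom_adj (k : ℕ) (hk : 2 ≤ k) (a b : Fin (2*k) ⊕ Fin 4) :
    (doubleBroom (2*k)).Adj a b ↔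
      (baseR k (codeEquiv k a) (codeEquiv k b) ∨ baseR k (codeEquiv k b) (codeEquiv k a)) := by
  unfold doubleBroom
  rw [SimpleGraph.fromRel_adj, ← (codeEquiv k).injective.ne_iff, ne_eq, Fin.ext_iff]
  rcases a with i | l <;> rcases b with j | l' <;>
    simp only [codeEquiv_inl, baseR, or_false, false_or, and_false, false_iff]
  · omega
  · have h := codeEquiv_inr k l'
    generalize ((codeEquiv k (Sum.inr l') : Fin _) : ℕ) = c at *
    omega
  · have h := codeEquiv_inr k l
    generalize ((codeEquiv k (Sum.inr l) : Fin _) : ℕ) = c at *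
    omega
  · have h := codeEquiv_inr k l
    have h' := codeEquiv_inr k l'
    generalize ((codeEquiv k (Sum.inr l) : Fin _) : ℕ) = c at *
    generalize ((codeEquiv k (Sum.inr l') : Fin _) : ℕ) = c' at *
    omega

lemma base_lt (k i j : ℕ) (h : baseR k i j) : i < j := by
  unfold baseR at h; omega

lemma base_cut (k c i j : ℕ) (hc : 2 ≤ c) (hck : c ≤ 2*k) (h : baseR k i j) (hi : i = c) :
    j = c + 1 := by
  unfold baseR at h; omega

lemma base_tri (k i j l : ℕ) (h1 : baseR k i j) (h2 : baseR k j l) (h3 : baseR k i l) :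
    False := by
  unfold baseR at h1 h2 h3; omega

lemma cut_adj (k c : ℕ) (hk : 2 ≤ k) (r s : Fin (2*k)) (hr : (r:ℕ) + 2 = c)
    (hs : (s:ℕ) = r + 1) (a b : Fin (2*k) ⊕ Fin 4) :
    ((doubleBroom (2*k)).deleteEdges {s(Sum.inl r, Sum.inl s)}).Adj a b ↔
      cutR k c (codeEquiv k a) (codeEquiv k b) := by
  rw [SimpleGraph.deleteEdges_adj, broom_adj k hk, Set.mem_singleton_iff, Sym2.eq_iff,
    ← (codeEquiv k).injective.eq_iff, ← (codeEquiv k).injective.eq_iff (a := b),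
    ← (codeEquiv k).injective.eq_iff (a := a), ← (codeEquiv k).injective.eq_iff (a := b)]
  simp only [Fin.ext_iff, codeEquiv_inl]
  have h1 := base_cut k c (codeEquiv k a) (codeEquiv k b) (by omega) (by omega)
  have h2 := base_cut k c (codeEquiv k b) (codeEquiv k a) (by omega) (by omega)
  have h3 := base_lt k (codeEquiv k a) (codeEquiv k b)
  have h4 := base_lt k (codeEquiv k b) (codeEquiv k a)
  rw [hs, show (r:ℕ) + 1 + 2 = c + 1 by omega, hr]
  unfold cutR
  generalize ((codeEquiv k a : Fin _) : ℕ) = i at *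
  generalize ((codeEquiv k b : Fin _) : ℕ) = j at *
  constructor
  · rintro ⟨h | h, hn⟩
    · exact Or.inl ⟨h, fun hc => hn (Or.inl ⟨hc, h1 h hc⟩)⟩
    · exact Or.inr ⟨h, fun hc => hn (Or.inr ⟨h2 h hc, hc⟩)⟩
  · rintro (⟨h, hn⟩ | ⟨h, hn⟩)
    · have := h3 h
      exact ⟨Or.inl h, by have h5 := h1 h; unfold baseR at h; omega⟩
    · have := h4 h
      exact ⟨Or.inr h, by have h5 := h2 h; unfold baseR at h; omega⟩

lemma two_cards (k : ℕ) (hk : 2 ≤ k) (r s t : Fin (2*k)) (hr : (r:ℕ) + 2 = k)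
    (hs : (s:ℕ) = r + 1) (ht : (t:ℕ) = s + 1)
    {W : Type} (H : SimpleGraph W) (f1 f2 : Sym2 W) (hf1 : f1 ∈ H.edgeSet) (hf2 : f2 ∈ H.edgeSet)
    (hne : f1 ≠ f2)
    (α : H.deleteEdges {f1} ≃g (doubleBroom (2*k)).deleteEdges {s(Sum.inl s, Sum.inl t)})
    (β : H.deleteEdges {f2} ≃g (doubleBroom (2*k)).deleteEdges {s(Sum.inl r, Sum.inl s)}) :
    Nonempty (H ≃g doubleBroom (2*k)) := by
  induction f1 using Sym2.ind with | _ a b =>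
  induction f2 using Sym2.ind with | _ c d =>
  rw [SimpleGraph.mem_edgeSet] at hf1 hf2
  let γ : W ≃ Fin (2*k+4) := α.toEquiv.trans (codeEquiv k)
  have hγ : ∀ u v, cutR k (k+1) (γ u) (γ v) ↔ (H.Adj u v ∧ ¬ s(u,v) = s(a,b)) := by
    intro u v
    have h1 := cut_adj k (k+1) hk s t (by omega) ht (α u) (α v)
    rw [α.map_adj_iff, SimpleGraph.deleteEdges_adj, Set.mem_singleton_iff] at h1
    exact h1.symm
  have hγ' : ∀ u v, H.Adj u v ↔ (cutR k (k+1) (γ u) (γ v) ∨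
      (γ u = γ a ∧ γ v = γ b) ∨ (γ u = γ b ∧ γ v = γ a)) := by
    intro u v
    rw [hγ]
    simp only [γ.injective.eq_iff]
    rw [← Sym2.eq_iff]
    constructor
    · intro h; tauto
    · rintro (h | h)
      · exact h.1
      · rw [← SimpleGraph.mem_edgeSet, h]; exact hf1
  let δ : W ≃ Fin (2*k+4) := β.toEquiv.trans (codeEquiv k)
  have hδ : ∀ u v, cutR k k (δ u) (δ v) ↔ (H.Adj u v ∧ ¬ s(u,v) = s(c,d)) := by
    intro u v
    have h1 := cut_adj k k hk r s (by omega) hs (β u) (β v)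
    rw [β.map_adj_iff, SimpleGraph.deleteEdges_adj, Set.mem_singleton_iff] at h1
    exact h1.symm
  obtain ⟨σ, hσ, hxy⟩ := core3 k hk (γ a) (γ b) (γ c) (γ d) (γ.symm.trans δ) (by
    intro u v
    obtain ⟨u, rfl⟩ := γ.surjective u
    obtain ⟨v, rfl⟩ := γ.surjective v
    simp only [Equiv.trans_apply, Equiv.symm_apply_apply]
    rw [hδ, hγ', Sym2.eq_iff]
    simp only [γ.injective.eq_iff]) (by
    rw [hγ]; exact ⟨hf2, fun h => hne h.symm⟩)
  refine ⟨⟨γ.trans (σ.trans (codeEquiv k).symm), ?_⟩⟩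
  intro u v
  rw [broom_adj k hk, hγ']
  simp only [Equiv.trans_apply, Equiv.apply_symm_apply]
  rw [← hσ, ← σ.injective.eq_iff, ← σ.injective.eq_iff (a := γ v),
    ← σ.injective.eq_iff (a := γ u), ← σ.injective.eq_iff (a := γ v)]
  simp only [Fin.ext_iff]
  have hm : ∀ i j : ℕ, (baseR k i j ∨ baseR k j i) ↔
      (cutR k (k+1) i j ∨ (i = k+1 ∧ j = k+2) ∨ (i = k+2 ∧ j = k+1)) := by
    intro i j
    unfold cutR
    have h1 := base_cut k (k+1) i j (by omega) (by omega)
    have h2 := base_cut k (k+1) j i (by omega) (by omega)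
    have h3 : baseR k (k+1) (k+2) := by unfold baseR; omega
    constructor
    · rintro (h | h)
      · by_cases hc : i = k+1
        · exact Or.inr (Or.inl ⟨hc, h1 h hc⟩)
        · exact Or.inl (Or.inl ⟨h, hc⟩)
      · by_cases hc : j = k+1
        · exact Or.inr (Or.inr ⟨h2 h hc, hc⟩)
        · exact Or.inl (Or.inr ⟨h, hc⟩)
    · rintro ((h | h) | ⟨rfl, rfl⟩ | ⟨rfl, rfl⟩)
      · exact Or.inl h.1
      · exact Or.inr h.1
      · exact Or.inl h3
      · exact Or.inr h3
  rw [hm]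
  rcases hxy with ⟨e1, e2⟩ | ⟨e1, e2⟩
  · rw [e1, e2]
  · rw [e1, e2]
    tauto

lemma no_triangle (k : ℕ) (hk : 2 ≤ k) (a b c : Fin (2*k) ⊕ Fin 4)
    (h1 : (doubleBroom (2*k)).Adj a b) (h2 : (doubleBroom (2*k)).Adj a c)
    (h3 : (doubleBroom (2*k)).Adj b c) : False := by
  rw [broom_adj k hk] at h1 h2 h3
  rcases h1 with h1 | h1 <;> rcases h2 with h2 | h2 <;> rcases h3 with h3 | h3 <;>
    first
    | exact base_tri k _ _ _ h1 h3 h2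
    | exact base_tri k _ _ _ h2 h3 h1
    | exact base_tri k _ _ _ h1 h2 h3
    | exact base_tri k _ _ _ h2 h1 h3
    | exact base_tri k _ _ _ h3 h1 h2
    | exact base_tri k _ _ _ h3 h2 h1
    | (have := base_lt k _ _ h1
       have := base_lt k _ _ h2
       have := base_lt k _ _ h3
       omega)

/-- One card never suffices: replace the deleted edge by an edge closing a triangle. -/
lemma one_card (k : ℕ) (hk : 2 ≤ k) (e : Sym2 (Fin (2*k) ⊕ Fin 4)) :
    ∃ (H : SimpleGraph (Fin (2*k) ⊕ Fin 4)) (f : Sym2 (Fin (2*k) ⊕ Fin 4)), f ∈ H.edgeSet ∧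
      H.deleteEdges {f} = (doubleBroom (2*k)).deleteEdges {e} ∧
      ¬ Nonempty (H ≃g doubleBroom (2*k)) := by
  have main : ∀ c l l' : Fin (2*k) ⊕ Fin 4, (doubleBroom (2*k)).Adj c l →
      (doubleBroom (2*k)).Adj c l' → l ≠ l' → s(c,l) ≠ e → s(c,l') ≠ e →
      ∃ (H : SimpleGraph (Fin (2*k) ⊕ Fin 4)) (f : Sym2 (Fin (2*k) ⊕ Fin 4)), f ∈ H.edgeSet ∧
      H.deleteEdges {f} = (doubleBroom (2*k)).deleteEdges {e} ∧
      ¬ Nonempty (H ≃g doubleBroom (2*k)) := by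
    intro c l l' h1 h2 hne he1 he2
    have hH : ∀ u v, ((doubleBroom (2*k)).deleteEdges {e} ⊔ SimpleGraph.edge l l').Adj u v ↔
        (((doubleBroom (2*k)).Adj u v ∧ ¬ s(u,v) = e) ∨ s(u,v) = s(l,l')) := by
      intro u v
      rw [SimpleGraph.sup_adj, SimpleGraph.deleteEdges_adj, Set.mem_singleton_iff,
        SimpleGraph.edge_adj, Sym2.eq_iff]
      constructor
      · tauto
      · rintro (h | h)
        · exact Or.inl h
        · refine Or.inr ⟨h, ?_⟩
          rcases h with ⟨rfl, rfl⟩ | ⟨rfl, rfl⟩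
          · exact hne
          · exact hne.symm
    refine ⟨(doubleBroom (2*k)).deleteEdges {e} ⊔ SimpleGraph.edge l l', s(l,l'), ?_, ?_, ?_⟩
    · rw [SimpleGraph.mem_edgeSet, hH]; exact Or.inr rfl
    · ext u v
      rw [SimpleGraph.deleteEdges_adj, SimpleGraph.deleteEdges_adj, hH]
      simp only [Set.mem_singleton_iff]
      constructor
      · tauto
      · intro h
        refine ⟨Or.inl h, fun h' => ?_⟩
        have h4 := h.1
        rw [← SimpleGraph.mem_edgeSet, h', SimpleGraph.mem_edgeSet] at h4
        exact no_triangle k hk _ _ _ h1 h2 h4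
    · rintro ⟨φ⟩
      refine no_triangle k hk (φ c) (φ l) (φ l') ?_ ?_ ?_ <;> rw [φ.map_adj_iff, hH]
      · exact Or.inl ⟨h1, he1⟩
      · exact Or.inl ⟨h2, he2⟩
      · exact Or.inr rfl
  by_cases h : s(Sum.inl ⟨0, by omega⟩, Sum.inr 0) = e ∨ s(Sum.inl ⟨0, by omega⟩, Sum.inr 1) = e
  · refine main (Sum.inl ⟨2*k-1, by omega⟩) (Sum.inr 2) (Sum.inr 3) ?_ ?_ (by simp) ?_ ?_
    · simp [doubleBroom]
    · simp [doubleBroom]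
    · rcases h with rfl | rfl <;> simp
    · rcases h with rfl | rfl <;> simp
  · push Not at h
    refine main (Sum.inl ⟨0, by omega⟩) (Sum.inr 0) (Sum.inr 1) ?_ ?_ (by simp) h.1 h.2
    · simp [doubleBroom]
    · simp [doubleBroom]

/-- For every odd `d ≥ 5`, the caterpillar `C(2,0,…,0,2)` with spine on `d - 1` vertices
(hence of diameter `d`) has edge-reconstruction number 2. -/
theorem stmt11 (d : ℕ) (hd : 5 ≤ d) (ho : Odd d) : ern (doubleBroom (d - 1)) = 2 := by
  obtain ⟨k, rfl⟩ := ho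
  have hk : 2 ≤ k := by omega
  rw [Nat.add_sub_cancel]
  have h2 : 2 ∈ {n | ∃ s : Finset (Sym2 (Fin (2*k) ⊕ Fin 4)), s.card = n ∧
      (↑s : Set (Sym2 (Fin (2*k) ⊕ Fin 4))) ⊆ (doubleBroom (2*k)).edgeSet ∧
      ∀ (W : Type) (_ : Fintype W) (H : SimpleGraph W) (t : Finset (Sym2 W)),
        (↑t : Set (Sym2 W)) ⊆ H.edgeSet →
        (∃ φ : {e // e ∈ s} ≃ {f // f ∈ t},
          ∀ e : {e // e ∈ s},
            Nonempty (H.deleteEdges {(φ e).1} ≃g (doubleBroom (2*k)).deleteEdges {e.1})) →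
        Nonempty (H ≃g doubleBroom (2*k))} := by
    let r : Fin (2*k) := ⟨k-2, by omega⟩
    let s : Fin (2*k) := ⟨k-1, by omega⟩
    let t : Fin (2*k) := ⟨k, by omega⟩
    have hrs : (s:ℕ) = r + 1 := by simp only [r, s]; omega
    have hst : (t:ℕ) = s + 1 := by simp only [t, s]; omega
    have hr : (r:ℕ) + 2 = k := by simp only [r]; omega
    have hne : (s(Sum.inl s, Sum.inl t) : Sym2 (Fin (2*k) ⊕ Fin 4)) ≠ s(Sum.inl r, Sum.inl s) := by
      rw [ne_eq, Sym2.eq_iff]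
      simp only [Sum.inl.injEq, Fin.ext_iff]
      omega
    refine ⟨{s(Sum.inl s, Sum.inl t), s(Sum.inl r, Sum.inl s)}, Finset.card_pair hne, ?_, ?_⟩
    · intro e he
      simp only [Finset.coe_insert, Finset.coe_singleton, Set.mem_insert_iff,
        Set.mem_singleton_iff] at he
      rcases he with rfl | rfl <;>
      · rw [SimpleGraph.mem_edgeSet, broom_adj k hk]
        simp only [codeEquiv_inl, baseR]
        omega
    · rintro W _ H T hT ⟨φ, hφ⟩
      obtain ⟨α⟩ := hφ ⟨s(Sum.inl s, Sum.inl t), by simp⟩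
      obtain ⟨β⟩ := hφ ⟨s(Sum.inl r, Sum.inl s), by simp⟩
      refine two_cards k hk r s t hr hrs hst H _ _ (hT (φ _).2) (hT (φ _).2) ?_ α β
      intro h
      have := φ.injective (Subtype.ext h)
      exact hne (congrArg Subtype.val this)
  unfold ern
  refine le_antisymm (Nat.sInf_le h2) (le_csInf ⟨2, h2⟩ ?_)
  rintro n ⟨s, hs, -, hs2⟩
  by_contra hn
  have hn' : n = 0 ∨ n = 1 := by omega
  rcases hn' with rfl | rfl
  · rw [Finset.card_eq_zero] at hs
    subst hs
    obtain ⟨φ⟩ := hs2 Empty inferInstance ⊥ ∅ (by simp)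
      ⟨Equiv.equivOfIsEmpty _ _, fun e => (Finset.notMem_empty _ e.2).elim⟩
    exact (φ.symm (Sum.inr 0)).elim
  · rw [Finset.card_eq_one] at hs
    obtain ⟨e, rfl⟩ := hs
    obtain ⟨H, f, hf, he, hno⟩ := one_card k hk e
    apply hno
    refine hs2 _ inferInstance H {f} (by simpa using hf) ⟨⟨fun _ => ⟨f, by simp⟩,
      fun _ => ⟨e, by simp⟩, ?_, ?_⟩, ?_⟩
    · rintro ⟨e', h⟩; exact Subtype.ext (Finset.mem_singleton.1 h).symm
    · rintro ⟨e', h⟩; exact Subtype.ext (Finset.mem_singleton.1 h).symm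
    · rintro ⟨e', h⟩
      obtain rfl := Finset.mem_singleton.1 h
      simp only [Equiv.coe_fn_mk]
      rw [he]
      exact ⟨SimpleGraph.Iso.refl⟩

end ErnPaper
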